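/- Let u, v : ℝ² → ℝ be smooth on the open half-plane {(ξ,η) : η > 0} and satisfy the Cauchy–Riemann equations ∂u/∂ξ = ∂v/∂η and ∂u/∂η = −∂v/∂ξ there (so that f = u + iv is holomorphic). On the open set Ω = {x ∈ ℝ⁴ : x⃗ ≠ 0}, with ρ = ‖x⃗‖, define F₀(x) = u(x₀, ρ) and F_l(x) = (x_l/ρ)·v(x₀, ρ) for l = 1,2,3, and set g_a = ΔF_a for a = 0,1,2,3. Then F₀, F₁, F₂, F₃ are smooth on Ω and the following system of equations holds on Ω: ∂₀g₀ = ∂₁g₁ + ∂₂g₂ + ∂₃g₃; ∂₀g_l = −∂_l g₀ for l = 1,2,3; and ∂_i g_j = ∂_j g_i for 1 ≤ i < j ≤ 3. -/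

import Mathlib

/-- Directional (partial) derivative of a function on ℝ² in direction `d`. -/
noncomputable def pd2 (d : ℝ × ℝ) (u : ℝ × ℝ → ℝ) : ℝ × ℝ → ℝ :=
  fun p => fderiv ℝ u p d

/-- The `i`-th partial derivative of `f : ℝ⁴ → ℝ`. -/
noncomputable def pd (i : Fin 4) (f : EuclideanSpace ℝ (Fin 4) → ℝ) :
    EuclideanSpace ℝ (Fin 4) → ℝ :=
  fun x => fderiv ℝ f x (EuclideanSpace.single i 1)

/-- The Laplacian of `f : ℝ⁴ → ℝ`. -/
noncomputable def laplacian (f : EuclideanSpace ℝ (Fin 4) → ℝ) :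
    EuclideanSpace ℝ (Fin 4) → ℝ :=
  fun x => ∑ i : Fin 4, pd i (pd i f) x

/-- `ρ x = ‖x⃗‖`, the length of the vector part of `x ∈ ℝ⁴`. -/
noncomputable def rho (x : EuclideanSpace ℝ (Fin 4)) : ℝ :=
  Real.sqrt ((x 1) ^ 2 + (x 2) ^ 2 + (x 3) ^ 2)

/-- The open set `Ω = {x ∈ ℝ⁴ : x⃗ ≠ 0}`. -/
def Omega : Set (EuclideanSpace ℝ (Fin 4)) :=
  {x | ¬(x 1 = 0 ∧ x 2 = 0 ∧ x 3 = 0)}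

/-- The components of `F = u(x₀,ρ) + (x⃗/ρ) v(x₀,ρ)`:
`F₀ = u(x₀,ρ)` and `F_l = (x_l/ρ) v(x₀,ρ)` for `l = 1,2,3`. -/
noncomputable def Fcomp (u v : ℝ × ℝ → ℝ) (a : Fin 4) :
    EuclideanSpace ℝ (Fin 4) → ℝ :=
  fun x => if a = 0 then u (x 0, rho x) else (x a / rho x) * v (x 0, rho x)

open scoped ContDiff

/-- The open upper half-plane in `ℝ × ℝ`. -/
def upperHalf : Set (ℝ × ℝ) := {p | 0 < p.2}

/-- The function `x ↦ w (x₀, ρ)` on `ℝ⁴` attached to a function `w` of two variables. -/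
noncomputable def axialLift (w : ℝ × ℝ → ℝ) : EuclideanSpace ℝ (Fin 4) → ℝ :=
  fun x => w (x 0, rho x)

/-- The operator `w ↦ η⁻¹ ∂w/∂η`. -/
noncomputable def radialDeriv (w : ℝ × ℝ → ℝ) : ℝ × ℝ → ℝ :=
  fun p => pd2 (0, 1) w p / p.2

lemma isOpen_upperHalf : IsOpen upperHalf :=
  isOpen_lt continuous_const continuous_snd

lemma upperHalf_mem_nhds {p : ℝ × ℝ} (hp : p ∈ upperHalf) : upperHalf ∈ nhds p :=
  isOpen_upperHalf.mem_nhds hp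

lemma differentiableAt_of_contDiffOn_upperHalf {w : ℝ × ℝ → ℝ}
    (hw : ContDiffOn ℝ ∞ w upperHalf) {p : ℝ × ℝ} (hp : p ∈ upperHalf) :
    DifferentiableAt ℝ w p :=
  (hw.contDiffAt (upperHalf_mem_nhds hp)).differentiableAt (by simp)

lemma pd2_congr {d : ℝ × ℝ} {f g : ℝ × ℝ → ℝ} (h : Set.EqOn f g upperHalf) :
    Set.EqOn (pd2 d f) (pd2 d g) upperHalf := fun p hp => by
  simp only [pd2, (h.eventuallyEq_of_mem (upperHalf_mem_nhds hp)).fderiv_eq]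

lemma contDiffOn_pd2 {w : ℝ × ℝ → ℝ} (hw : ContDiffOn ℝ ∞ w upperHalf) (d : ℝ × ℝ) :
    ContDiffOn ℝ ∞ (pd2 d w) upperHalf :=
  (hw.fderiv_of_isOpen isOpen_upperHalf (by simp)).clm_apply contDiffOn_const

lemma contDiffOn_div_snd_pow {w : ℝ × ℝ → ℝ} (hw : ContDiffOn ℝ ∞ w upperHalf) (n : ℕ) :
    ContDiffOn ℝ ∞ (fun p => w p / p.2 ^ n) upperHalf :=
  hw.div (contDiff_snd.pow n).contDiffOn fun _ hp => pow_ne_zero n (ne_of_gt hp)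

lemma contDiffOn_radialDeriv {w : ℝ × ℝ → ℝ} (hw : ContDiffOn ℝ ∞ w upperHalf) :
    ContDiffOn ℝ ∞ (radialDeriv w) upperHalf := by
  have h := contDiffOn_div_snd_pow (contDiffOn_pd2 hw (0, 1)) 1
  simp only [pow_one] at h
  exact h

lemma pd2_comm {w : ℝ × ℝ → ℝ} (hw : ContDiffOn ℝ ∞ w upperHalf) (d e : ℝ × ℝ)
    {p : ℝ × ℝ} (hp : p ∈ upperHalf) : pd2 d (pd2 e w) p = pd2 e (pd2 d w) p := by
  have hcd := hw.contDiffAt (upperHalf_mem_nhds hp)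
  have hd : DifferentiableAt ℝ (fderiv ℝ w) p :=
    (hcd.fderiv_right (m := 1) (by norm_cast)).differentiableAt (by simp)
  have hsymm : IsSymmSndFDerivAt ℝ w p := hcd.isSymmSndFDerivAt (by
    rw [minSmoothness_of_isRCLikeNormedField]
    norm_cast)
  have key : ∀ a b : ℝ × ℝ, pd2 a (pd2 b w) p = fderiv ℝ (fderiv ℝ w) p a b := by
    intro a b
    have h := hd.hasFDerivAt.clm_apply (hasFDerivAt_const b p)
    change fderiv ℝ (fun q => fderiv ℝ w q b) p a = _
    rw [h.fderiv]
    simp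
  rw [key, key, hsymm.eq]

lemma pd2_div_snd_pow {w : ℝ × ℝ → ℝ} (hw : ContDiffOn ℝ ∞ w upperHalf) (n : ℕ)
    (d : ℝ × ℝ) {p : ℝ × ℝ} (hp : p ∈ upperHalf) :
    pd2 d (fun q => w q / q.2 ^ n) p =
      pd2 d w p / p.2 ^ n - n * d.2 * w p / p.2 ^ (n + 1) := by
  have hne : p.2 ≠ 0 := ne_of_gt hp
  have h := (differentiableAt_of_contDiffOn_upperHalf hw hp).hasFDerivAt.mul
    ((hasDerivAt_inv (pow_ne_zero n hne)).comp_hasFDerivAt p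
      ((hasDerivAt_pow n p.2).comp_hasFDerivAt p (hasFDerivAt_snd (𝕜 := ℝ))))
  have h' : HasFDerivAt (fun q : ℝ × ℝ => w q / q.2 ^ n) _ p := h
  rw [pd2, h'.fderiv, pd2]
  rcases n with _ | n
  · simp
  · simp
    field_simp
    ring

lemma pd2_sub {f g : ℝ × ℝ → ℝ} (hf : ContDiffOn ℝ ∞ f upperHalf)
    (hg : ContDiffOn ℝ ∞ g upperHalf) (d : ℝ × ℝ) {p : ℝ × ℝ} (hp : p ∈ upperHalf) :
    pd2 d (fun q => f q - g q) p = pd2 d f p - pd2 d g p := by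
  simp only [pd2]
  rw [fderiv_fun_sub (differentiableAt_of_contDiffOn_upperHalf hf hp)
    (differentiableAt_of_contDiffOn_upperHalf hg hp)]
  simp

lemma pd2_const_mul (c : ℝ) (f : ℝ × ℝ → ℝ) (d p : ℝ × ℝ) :
    pd2 d (fun q => c * f q) p = c * pd2 d f p := by
  change fderiv ℝ (c • f) p d = _
  rw [fderiv_const_smul_field]
  simp [pd2]

lemma pd2_neg (f : ℝ × ℝ → ℝ) (d p : ℝ × ℝ) : pd2 d (fun q => -f q) p = -pd2 d f p := by
  simp [pd2]

lemma isOpen_Omega : IsOpen Omega := by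
  have : Omega = {x : EuclideanSpace ℝ (Fin 4) | x 1 = 0 ∧ x 2 = 0 ∧ x 3 = 0}ᶜ := rfl
  rw [this]
  refine IsClosed.isOpen_compl (self := ?_)
  exact (isClosed_eq (by fun_prop) continuous_const).inter
    ((isClosed_eq (by fun_prop) continuous_const).inter
      (isClosed_eq (by fun_prop) continuous_const))

lemma Omega_mem_nhds {x : EuclideanSpace ℝ (Fin 4)} (hx : x ∈ Omega) : Omega ∈ nhds x :=
  isOpen_Omega.mem_nhds hx

lemma sum_sq_pos {x : EuclideanSpace ℝ (Fin 4)} (hx : x ∈ Omega) :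
    0 < (x 1) ^ 2 + (x 2) ^ 2 + (x 3) ^ 2 := by
  by_contra! h
  exact hx ⟨by nlinarith [sq_nonneg (x 1), sq_nonneg (x 2), sq_nonneg (x 3)],
    by nlinarith [sq_nonneg (x 1), sq_nonneg (x 2), sq_nonneg (x 3)],
    by nlinarith [sq_nonneg (x 1), sq_nonneg (x 2), sq_nonneg (x 3)]⟩

lemma rho_pos {x : EuclideanSpace ℝ (Fin 4)} (hx : x ∈ Omega) : 0 < rho x :=
  Real.sqrt_pos.2 (sum_sq_pos hx)

lemma rho_sq (x : EuclideanSpace ℝ (Fin 4)) :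
    rho x ^ 2 = (x 1) ^ 2 + (x 2) ^ 2 + (x 3) ^ 2 :=
  Real.sq_sqrt (by positivity)

lemma axial_mem_upperHalf {x : EuclideanSpace ℝ (Fin 4)} (hx : x ∈ Omega) :
    (x 0, rho x) ∈ upperHalf :=
  rho_pos hx

lemma contDiff_coord (i : Fin 4) :
    ContDiff ℝ ∞ (fun x : EuclideanSpace ℝ (Fin 4) => x i) :=
  (EuclideanSpace.proj (𝕜 := ℝ) i).contDiff

lemma hasFDerivAt_coord (i : Fin 4) (x : EuclideanSpace ℝ (Fin 4)) :
    HasFDerivAt (fun x : EuclideanSpace ℝ (Fin 4) => x i)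
      (EuclideanSpace.proj (𝕜 := ℝ) i) x :=
  (EuclideanSpace.proj (𝕜 := ℝ) i).hasFDerivAt

lemma contDiffOn_rho : ContDiffOn ℝ ∞ rho Omega :=
  ContDiffOn.sqrt ((((contDiff_coord 1).pow 2).add ((contDiff_coord 2).pow 2)).add
    ((contDiff_coord 3).pow 2)).contDiffOn fun _ hx => (sum_sq_pos hx).ne'

lemma contDiffOn_axialLift {w : ℝ × ℝ → ℝ} (hw : ContDiffOn ℝ ∞ w upperHalf) :
    ContDiffOn ℝ ∞ (axialLift w) Omega :=
  hw.comp ((contDiff_coord 0).contDiffOn.prodMk contDiffOn_rho)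
    fun _ hx => axial_mem_upperHalf hx

lemma differentiableAt_axialLift {w : ℝ × ℝ → ℝ} (hw : ContDiffOn ℝ ∞ w upperHalf)
    {x : EuclideanSpace ℝ (Fin 4)} (hx : x ∈ Omega) : DifferentiableAt ℝ (axialLift w) x :=
  ((contDiffOn_axialLift hw).contDiffAt (Omega_mem_nhds hx)).differentiableAt (by simp)

lemma pd_congr {i : Fin 4} {f g : EuclideanSpace ℝ (Fin 4) → ℝ} (h : Set.EqOn f g Omega) :
    Set.EqOn (pd i f) (pd i g) Omega := fun x hx => by
  simp only [pd, (h.eventuallyEq_of_mem (Omega_mem_nhds hx)).fderiv_eq]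

lemma axialLift_congr {w z : ℝ × ℝ → ℝ} (h : Set.EqOn w z upperHalf) :
    Set.EqOn (axialLift w) (axialLift z) Omega :=
  fun _ hx => h (axial_mem_upperHalf hx)

lemma pd_coord_mul {f : EuclideanSpace ℝ (Fin 4) → ℝ} {x : EuclideanSpace ℝ (Fin 4)}
    (hf : DifferentiableAt ℝ f x) (i l : Fin 4) :
    pd i (fun y => y l * f y) x = (if l = i then f x else 0) + x l * pd i f x := by
  have h := (hasFDerivAt_coord l x).mul hf.hasFDerivAt
  have h' : HasFDerivAt (fun y : EuclideanSpace ℝ (Fin 4) => y l * f y) _ x := h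
  rw [pd, h'.fderiv]
  by_cases hli : l = i <;> simp [pd, hli, add_comm]

lemma pd_add {f g : EuclideanSpace ℝ (Fin 4) → ℝ} {x : EuclideanSpace ℝ (Fin 4)}
    (hf : DifferentiableAt ℝ f x) (hg : DifferentiableAt ℝ g x) (i : Fin 4) :
    pd i (fun y => f y + g y) x = pd i f x + pd i g x := by
  rw [pd, fderiv_fun_add hf hg]
  rfl

lemma fderiv_rho {x : EuclideanSpace ℝ (Fin 4)} (hx : x ∈ Omega) (i : Fin 4) :
    fderiv ℝ rho x (EuclideanSpace.single i 1) = if i = 0 then 0 else x i / rho x := by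
  have h : HasFDerivAt rho _ x :=
    ((((hasFDerivAt_coord 1 x).pow 2).add ((hasFDerivAt_coord 2 x).pow 2)).add
      ((hasFDerivAt_coord 3 x).pow 2)).sqrt (sum_sq_pos hx).ne'
  have hr := rho_pos hx
  rw [h.fderiv]
  change 0 < √((x 1) ^ 2 + (x 2) ^ 2 + (x 3) ^ 2) at hr
  fin_cases i <;> simp [rho] <;> field_simp

lemma pd_axialLift {w : ℝ × ℝ → ℝ} (hw : ContDiffOn ℝ ∞ w upperHalf)
    {x : EuclideanSpace ℝ (Fin 4)} (hx : x ∈ Omega) (i : Fin 4) :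
    pd i (axialLift w) x =
      if i = 0 then axialLift (pd2 (1, 0) w) x else x i * axialLift (radialDeriv w) x := by
  have hrho : DifferentiableAt ℝ rho x :=
    (contDiffOn_rho.contDiffAt (Omega_mem_nhds hx)).differentiableAt (by simp)
  have h : HasFDerivAt (axialLift w) _ x :=
    (differentiableAt_of_contDiffOn_upperHalf hw (axial_mem_upperHalf hx)).hasFDerivAt.comp x
      ((hasFDerivAt_coord 0 x).prodMk hrho.hasFDerivAt)
  rw [pd, h.fderiv]
  simp only [ContinuousLinearMap.comp_apply, ContinuousLinearMap.prod_apply, fderiv_rho hx]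
  by_cases hi : i = 0
  · subst hi
    simp [axialLift, pd2]
  · have : ((0 : ℝ), x i / rho x) = (x i / rho x) • ((0 : ℝ), (1 : ℝ)) := by simp
    simp [hi, Ne.symm hi, axialLift, radialDeriv, pd2, this, -Prod.smul_mk]
    ring

lemma pd_pd_axialLift {w : ℝ × ℝ → ℝ} (hw : ContDiffOn ℝ ∞ w upperHalf)
    {x : EuclideanSpace ℝ (Fin 4)} (hx : x ∈ Omega) (i : Fin 4) :
    pd i (pd i (axialLift w)) x =
      if i = 0 then axialLift (pd2 (1, 0) (pd2 (1, 0) w)) x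
      else axialLift (radialDeriv w) x +
        x i ^ 2 * axialLift (radialDeriv (radialDeriv w)) x := by
  rw [pd_congr (fun y hy => pd_axialLift hw hy i) hx]
  have hr := contDiffOn_radialDeriv hw
  by_cases hi : i = 0
  · subst hi
    simpa using pd_axialLift (contDiffOn_pd2 hw (1, 0)) hx 0
  · simp only [hi, if_false]
    rw [pd_coord_mul (differentiableAt_axialLift hr hx), pd_axialLift hr hx]
    simp [hi]
    ring

lemma laplacian_axialLift {w : ℝ × ℝ → ℝ} (hw : ContDiffOn ℝ ∞ w upperHalf)
    {x : EuclideanSpace ℝ (Fin 4)} (hx : x ∈ Omega) :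
    laplacian (axialLift w) x =
      axialLift (fun p => pd2 (1, 0) (pd2 (1, 0) w) p + pd2 (0, 1) (pd2 (0, 1) w) p +
        2 * radialDeriv w p) x := by
  have hpos := rho_pos hx
  have hp := axial_mem_upperHalf hx
  have hE : radialDeriv (radialDeriv w) (x 0, rho x) =
      (pd2 (0, 1) (pd2 (0, 1) w) (x 0, rho x) / rho x -
        pd2 (0, 1) w (x 0, rho x) / rho x ^ 2) / rho x := by
    have := pd2_div_snd_pow (contDiffOn_pd2 hw (0, 1)) 1 (0, 1) hp
    simp only [pow_one, Nat.cast_one, one_mul, one_add_one_eq_two] at this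
    rw [radialDeriv]
    change pd2 (0, 1) (fun q => pd2 (0, 1) w q / q.2) _ / _ = _
    rw [this]
  simp only [laplacian, Fin.sum_univ_four, pd_pd_axialLift hw hx]
  simp only [axialLift, hE]
  simp only [one_ne_zero, if_true, if_false, Fin.reduceEq, radialDeriv]
  have h3 : x 3 ^ 2 = rho x ^ 2 - x 1 ^ 2 - x 2 ^ 2 := by rw [rho_sq]; ring
  rw [h3]
  field_simp
  ring

lemma laplacian_coord_mul_axialLift {w : ℝ × ℝ → ℝ} (hw : ContDiffOn ℝ ∞ w upperHalf)
    {x : EuclideanSpace ℝ (Fin 4)} (hx : x ∈ Omega) {l : Fin 4} (hl : l ≠ 0) :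
    laplacian (fun y => y l * axialLift w y) x =
      x l * axialLift (fun p => pd2 (1, 0) (pd2 (1, 0) w) p + pd2 (0, 1) (pd2 (0, 1) w) p +
        4 * radialDeriv w p) x := by
  have hpd : ∀ i : Fin 4, DifferentiableAt ℝ (pd i (axialLift w)) x := fun i =>
    ((((contDiffOn_axialLift hw).fderiv_of_isOpen isOpen_Omega
      (m := ∞) (by simp)).clm_apply contDiffOn_const).contDiffAt
        (Omega_mem_nhds hx)).differentiableAt (by simp)
  have hterm : ∀ i : Fin 4, pd i (pd i (fun y => y l * axialLift w y)) x =
      (if l = i then 2 * pd i (axialLift w) x else 0) + x l * pd i (pd i (axialLift w)) x := by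
    intro i
    rw [pd_congr (fun y hy => pd_coord_mul (differentiableAt_axialLift hw hy) i l) hx]
    by_cases hli : l = i
    · simp only [hli, if_true]
      rw [pd_add (differentiableAt_axialLift hw hx)
        ((hasFDerivAt_coord i x).differentiableAt.fun_mul (hpd i)), pd_coord_mul (hpd i)]
      simp
      ring
    · simp only [hli, if_false, zero_add]
      rw [pd_coord_mul (hpd i)]
      simp [hli]
  have hsum : laplacian (fun y => y l * axialLift w y) x =
      2 * pd l (axialLift w) x + x l * laplacian (axialLift w) x := by
    simp only [laplacian, hterm, Finset.sum_add_distrib, Finset.mul_sum]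
    simp
  rw [hsum, laplacian_axialLift hw hx, pd_axialLift hw hx]
  simp only [hl, if_false, axialLift]
  ring

lemma Fcomp_zero (u v : ℝ × ℝ → ℝ) : Fcomp u v 0 = axialLift u := by
  funext x
  simp [Fcomp, axialLift]

lemma Fcomp_of_ne_zero (u v : ℝ × ℝ → ℝ) {l : Fin 4} (hl : l ≠ 0) :
    Fcomp u v l = fun x => x l * axialLift (fun p => v p / p.2) x := by
  funext x
  simp only [Fcomp, hl, if_false, axialLift]
  ring

/-- Lemma 2 of the paper (componentwise form): if `f = u + iv` is holomorphic on the
upper half-plane, then `F(x) = u(x₀,ρ) + (x⃗/ρ) v(x₀,ρ)` is a holomorphic Cliffordian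
function on `Ω = {x⃗ ≠ 0}`: its components are smooth, and `g = ΔF` satisfies the
componentwise form of the Cauchy–Riemann–Fueter system `D g = 0`. -/
theorem holCliffordian_from_holomorphic (u v : ℝ × ℝ → ℝ)
    (hu : ContDiffOn ℝ (⊤ : ℕ∞) u {p : ℝ × ℝ | 0 < p.2})
    (hv : ContDiffOn ℝ (⊤ : ℕ∞) v {p : ℝ × ℝ | 0 < p.2})
    (hCR1 : ∀ p : ℝ × ℝ, 0 < p.2 → pd2 (1, 0) u p = pd2 (0, 1) v p)
    (hCR2 : ∀ p : ℝ × ℝ, 0 < p.2 → pd2 (0, 1) u p = -pd2 (1, 0) v p) :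
    (∀ a : Fin 4, ContDiffOn ℝ (⊤ : ℕ∞) (Fcomp u v a) Omega) ∧
    (∀ x ∈ Omega,
      pd 0 (laplacian (Fcomp u v 0)) x =
          pd 1 (laplacian (Fcomp u v 1)) x + pd 2 (laplacian (Fcomp u v 2)) x
            + pd 3 (laplacian (Fcomp u v 3)) x ∧
      (∀ l : Fin 4, l ≠ 0 →
        pd 0 (laplacian (Fcomp u v l)) x = -pd l (laplacian (Fcomp u v 0)) x) ∧
      (∀ i j : Fin 4, i ≠ 0 → j ≠ 0 →
        pd i (laplacian (Fcomp u v j)) x = pd j (laplacian (Fcomp u v i)) x)) := by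
  change ContDiffOn ℝ ∞ u upperHalf at hu
  change ContDiffOn ℝ ∞ v upperHalf at hv
  have hdiv : ContDiffOn ℝ ∞ (fun p : ℝ × ℝ => v p / p.2) upperHalf := by
    simpa using contDiffOn_div_snd_pow hv 1
  have hvx := contDiffOn_pd2 hv (1, 0)
  have hvy := contDiffOn_pd2 hv (0, 1)
  have hvharm : ∀ p ∈ upperHalf,
      pd2 (1, 0) (pd2 (1, 0) v) p = -pd2 (0, 1) (pd2 (0, 1) v) p := fun p hp => by
    have h1 := pd2_congr (d := (0, 1)) (fun q hq => hCR1 q hq) hp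
    have h2 := pd2_congr (d := (1, 0)) (fun q hq => hCR2 q hq) hp
    rw [pd2_neg] at h2
    have h3 := pd2_comm hu (1, 0) (0, 1) hp
    linarith
  have huharm : ∀ p ∈ upperHalf,
      pd2 (1, 0) (pd2 (1, 0) u) p = -pd2 (0, 1) (pd2 (0, 1) u) p := fun p hp => by
    have h1 := pd2_congr (d := (1, 0)) (fun q hq => hCR1 q hq) hp
    have h2 := pd2_congr (d := (0, 1)) (fun q hq => hCR2 q hq) hp
    rw [pd2_neg] at h2
    have h3 := pd2_comm hv (1, 0) (0, 1) hp
    linarith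
  -- The two-variable profiles of `g₀` and of `g_l / x_l`.
  set A : ℝ × ℝ → ℝ := fun p => -2 * (pd2 (1, 0) v p / p.2 ^ 1) with hA
  set B : ℝ × ℝ → ℝ := fun p => 2 * (pd2 (0, 1) v p / p.2 ^ 2 - v p / p.2 ^ 3) with hB
  have hAs : ContDiffOn ℝ ∞ A upperHalf :=
    contDiffOn_const.mul (contDiffOn_div_snd_pow hvx 1)
  have hBs : ContDiffOn ℝ ∞ B upperHalf :=
    contDiffOn_const.mul ((contDiffOn_div_snd_pow hvy 2).sub (contDiffOn_div_snd_pow hv 3))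
  have hg0 : Set.EqOn (laplacian (Fcomp u v 0)) (axialLift A) Omega := fun x hx => by
    rw [Fcomp_zero, laplacian_axialLift hu hx]
    refine axialLift_congr (fun p hp => ?_) hx
    simp only [huharm p hp, radialDeriv, hCR2 p hp, hA]
    ring
  have hgl : ∀ l : Fin 4, l ≠ 0 →
      Set.EqOn (laplacian (Fcomp u v l)) (fun x => x l * axialLift B x) Omega := by
    intro l hl x hx
    rw [Fcomp_of_ne_zero u v hl, laplacian_coord_mul_axialLift hdiv hx hl]
    congr 1
    refine axialLift_congr (fun p hp => ?_) hx
    have hne : p.2 ≠ 0 := ne_of_gt hp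
    have hx1 : Set.EqOn (pd2 (1, 0) fun q : ℝ × ℝ => v q / q.2)
        (fun q => pd2 (1, 0) v q / q.2 ^ 1) upperHalf := fun q hq => by
      simpa using pd2_div_snd_pow hv 1 (1, 0) hq
    have hy1 : Set.EqOn (pd2 (0, 1) fun q : ℝ × ℝ => v q / q.2)
        (fun q => pd2 (0, 1) v q / q.2 ^ 1 - v q / q.2 ^ 2) upperHalf := fun q hq => by
      simpa using pd2_div_snd_pow hv 1 (0, 1) hq
    simp only [radialDeriv]
    rw [pd2_congr hx1 hp, pd2_congr hy1 hp, hy1 hp, pd2_div_snd_pow hvx 1 _ hp,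
      pd2_sub (contDiffOn_div_snd_pow hvy 1) (contDiffOn_div_snd_pow hv 2) _ hp,
      pd2_div_snd_pow hvy 1 _ hp, pd2_div_snd_pow hv 2 _ hp, hvharm p hp]
    simp only [hB]
    push_cast
    field_simp
    ring
  have hAx : ∀ p ∈ upperHalf,
      pd2 (1, 0) A p = 3 * B p + p.2 ^ 2 * radialDeriv B p := fun p hp => by
    have hne : p.2 ≠ 0 := ne_of_gt hp
    simp only [radialDeriv, hA, hB]
    rw [pd2_const_mul, pd2_const_mul, pd2_div_snd_pow hvx 1 _ hp,
      pd2_sub (contDiffOn_div_snd_pow hvy 2) (contDiffOn_div_snd_pow hv 3) _ hp,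
      pd2_div_snd_pow hvy 2 _ hp, pd2_div_snd_pow hv 3 _ hp, hvharm p hp]
    push_cast
    field_simp
    ring
  have hBx : ∀ p ∈ upperHalf, pd2 (1, 0) B p = -radialDeriv A p := fun p hp => by
    have hne : p.2 ≠ 0 := ne_of_gt hp
    simp only [radialDeriv, hA, hB]
    rw [pd2_const_mul, pd2_const_mul, pd2_div_snd_pow hvx 1 _ hp,
      pd2_sub (contDiffOn_div_snd_pow hvy 2) (contDiffOn_div_snd_pow hv 3) _ hp,
      pd2_div_snd_pow hvy 2 _ hp, pd2_div_snd_pow hv 3 _ hp, pd2_comm hv (1, 0) (0, 1) hp]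
    push_cast
    field_simp
    ring
  have hpdl : ∀ x ∈ Omega, ∀ i l : Fin 4, l ≠ 0 → pd i (laplacian (Fcomp u v l)) x =
      (if l = i then axialLift B x else 0) + x l * pd i (axialLift B) x :=
    fun x hx i l hl => by
      rw [pd_congr (hgl l hl) hx, pd_coord_mul (differentiableAt_axialLift hBs hx)]
  refine ⟨fun a => ?_, fun x hx => ⟨?_, fun l hl => ?_, fun i j hi hj => ?_⟩⟩
  · by_cases ha : a = 0
    · rw [ha, Fcomp_zero]
      exact contDiffOn_axialLift hu
    · rw [Fcomp_of_ne_zero u v ha]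
      exact (contDiff_coord a).contDiffOn.mul (contDiffOn_axialLift hdiv)
  · rw [pd_congr hg0 hx, hpdl x hx 1 1 (by decide), hpdl x hx 2 2 (by decide),
      hpdl x hx 3 3 (by decide)]
    simp only [pd_axialLift hAs hx, pd_axialLift hBs hx, axialLift,
      hAx _ (axial_mem_upperHalf hx), rho_sq, one_ne_zero, if_true, if_false, Fin.reduceEq]
    ring
  · rw [pd_congr hg0 hx, hpdl x hx 0 l hl, pd_axialLift hAs hx, pd_axialLift hBs hx]
    simp [hl, axialLift, hBx _ (axial_mem_upperHalf hx)]
  · rw [hpdl x hx i j hj, hpdl x hx j i hi, pd_axialLift hBs hx, pd_axialLift hBs hx]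
    by_cases hij : i = j
    · rw [hij]
    · simp [hi, hj, hij, Ne.symm hij]
      ring
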